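/- Let p be a prime and let A be a normal Noetherian domain that is p-torsion-free and such that A/pA is F-finite (of characteristic p). If the ring A/pA is quasi-F-split, then A is quasi-F-split in the mixed-characteristic sense: there exist n ≥ 1 and an A-module homomorphism s : Q_{A,n} → A/pA such that the composite s ∘ Φ̃_{A,n} : A → A/pA equals the canonical surjection A → A/pA. -/

import Mathlib

/-!
# Statement 5

Let `p` be a prime and `A` a normal Noetherian domain which is `p`-torsion-free such that
`A/pA` is `F`-finite of characteristic `p`.  If `A/pA` is quasi-`F`-split, then `A` is
quasi-`F`-split in the mixed-characteristic sense: there are `n ≥ 1` and an `A`-module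
homomorphism `s : Q_{A,n} → A/pA` with `s ∘ Φ̃_{A,n}` the canonical surjection `A → A/pA`.
-/

open WittVector Function

noncomputable section

namespace QFS

variable (p : ℕ) [hp : Fact p.Prime] (A : Type) [CommRing A]

/-- vanishing of low coefficients of an iterated Verschiebung -/
theorem iterate_verschiebung_coeff_lt (y : WittVector p A) :
    ∀ (m i : ℕ), i < m → (verschiebung^[m] y).coeff i = 0 := by
  intro m
  induction m with
  | zero => intro i hi; omega
  | succ m ih =>
    intro i hi
    rw [Function.iterate_succ_apply']
    match i with
    | 0 => exact verschiebung_coeff_zero _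
    | Nat.succ j =>
      rw [verschiebung_coeff_succ]
      exact ih j (by omega)

/-- The constant coefficient map `R^k : W_{k+1}(A) → A` (the `k`-fold restriction). -/
def wittRes (k : ℕ) : TruncatedWittVector p (k + 1) A →+* A :=
  (RingHom.liftOfSurjective (WittVector.truncate (p := p) (R := A) (k + 1))
    (WittVector.truncate_surjective p (k + 1) A))
    ⟨WittVector.constantCoeff, by
      intro x hx
      rw [WittVector.mem_ker_truncate] at hx
      simp only [RingHom.mem_ker, WittVector.constantCoeff_apply]
      exact hx 0 (by omega)⟩

theorem wittRes_truncate (k : ℕ) (x : WittVector p A) :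
    wittRes p A k (WittVector.truncate (k + 1) x) = x.coeff 0 :=
  RingHom.liftOfRightInverse_comp_apply _ _ _ _ x

/-- The ring homomorphism `F : W_{n+1}(A) → W_n(A)` induced by the Witt vector Frobenius. -/
def wittFrob (n : ℕ) :
    TruncatedWittVector p (n + 1) A →+* TruncatedWittVector p n A :=
  (RingHom.liftOfSurjective (WittVector.truncate (p := p) (R := A) (n + 1))
    (WittVector.truncate_surjective p (n + 1) A))
    ⟨(WittVector.truncate n).comp (frobenius (p := p) (R := A)), by
      intro x hx
      rw [WittVector.mem_ker_truncate] at hx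
      simp only [RingHom.mem_ker, RingHom.comp_apply]
      rw [← RingHom.mem_ker, WittVector.mem_ker_truncate]
      intro i hi
      have hx' : x = verschiebung^[n + 1] (WittVector.mk p fun j => x.coeff (j + (n + 1))) := by
        apply WittVector.ext
        intro j
        rcases Nat.lt_or_ge j (n + 1) with h | h
        · rw [hx j h, iterate_verschiebung_coeff_lt p A _ _ _ h]
        · obtain ⟨l, rfl⟩ : ∃ l, j = l + (n + 1) := ⟨j - (n + 1), by omega⟩
          rw [iterate_verschiebung_coeff]
          rfl
      rw [hx', show (n + 1) = 1 + n by omega, Function.iterate_add_apply,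
        Function.iterate_one, frobenius_verschiebung, iterate_verschiebung_mul_left]
      exact iterate_verschiebung_coeff_lt p A _ _ _ hi⟩

theorem wittFrob_truncate (n : ℕ) (x : WittVector p A) :
    wittFrob p A n (WittVector.truncate (n + 1) x) = WittVector.truncate n (frobenius x) :=
  RingHom.liftOfRightInverse_comp_apply _ _ _ _ x

/-- The additive map `x ↦ (R^n x, -F x)` on `W_{n+1}(A)` whose cokernel is the pushout
`Q_{A,n}`. -/
def psiM (n : ℕ) :
    TruncatedWittVector p (n + 1) A →+ A × TruncatedWittVector p n A :=
  AddMonoidHom.mk' (fun x => (wittRes p A n x, - wittFrob p A n x)) (by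
    intro a b
    simp [Prod.ext_iff, map_add]
    abel)

/-- The pushout `Q_{A,n}` of `F : W_{n+1}(A) → F_*W_n(A)` and `R^n : W_{n+1}(A) → A`,
realized as the quotient of `A ⊕ F_*W_n(A)` by the graph relation. -/
def QM (n : ℕ) : Type :=
  (A × TruncatedWittVector p n A) ⧸ (psiM p A n).range

instance (n : ℕ) : AddCommGroup (QM p A n) :=
  QuotientAddGroup.Quotient.addCommGroup _

/-- Projection onto the pushout `Q_{A,n}`. -/
def mkM (n : ℕ) : A × TruncatedWittVector p n A →+ QM p A n :=
  QuotientAddGroup.mk' _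

/-- The pushout structure map `Φ̃_{A,n} : A → Q_{A,n}`, `a ↦ class of (a, 0)`. -/
def PhiM (n : ℕ) (a : A) : QM p A n :=
  mkM p A n (a, 0)

/-- The canonical map `q : F_*W_n(A) → Q_{A,n}`, `y ↦ class of (0, y)`. -/
def qM (n : ℕ) (y : TruncatedWittVector p n A) : QM p A n :=
  mkM p A n (0, y)

/-- The action of `W_{n+1}(A)` on representatives of elements of `Q_{A,n}`:
`A` is a `W_{n+1}(A)`-algebra via `R^n` and `F_*W_n(A)` is a `W_{n+1}(A)`-algebra via `F`. -/
def wsmulM (n : ℕ) (x : TruncatedWittVector p (n + 1) A)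
    (mm : A × TruncatedWittVector p n A) : A × TruncatedWittVector p n A :=
  (wittRes p A n x * mm.1, wittFrob p A n x * mm.2)

section CharP

variable (B : Type) [CommRing B] [CharP B p]

/-- The Witt vector Frobenius on `W_n(B)` for a ring `B` of characteristic `p`
(the coefficientwise `p`-th power map). -/
def wittFrobC (n : ℕ) : TruncatedWittVector p n B →+* TruncatedWittVector p n B :=
  (RingHom.liftOfSurjective (WittVector.truncate (p := p) (R := B) n)
    (WittVector.truncate_surjective p n B))
    ⟨(WittVector.truncate n).comp (frobenius (p := p) (R := B)), by
      intro x hx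
      rw [WittVector.mem_ker_truncate] at hx
      simp only [RingHom.mem_ker, RingHom.comp_apply]
      rw [← RingHom.mem_ker, WittVector.mem_ker_truncate]
      intro i hi
      rw [coeff_frobenius_charP, hx i hi, zero_pow hp.out.ne_zero]⟩

/-- The additive map `x ↦ (R^k x, -F x)` whose cokernel is the pushout `Q_{B,k+1}`
in characteristic `p`. -/
def psiC (k : ℕ) :
    TruncatedWittVector p (k + 1) B →+ B × TruncatedWittVector p (k + 1) B :=
  AddMonoidHom.mk' (fun x => (wittRes p B k x, - wittFrobC p B (k + 1) x)) (by
    intro a b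
    simp [Prod.ext_iff, map_add]
    abel)

/-- The pushout `Q_{B,k+1}` of `F : W_{k+1}(B) → F_*W_{k+1}(B)` and `R^k : W_{k+1}(B) → B` for a
ring `B` of characteristic `p`. -/
def QC (k : ℕ) : Type :=
  (B × TruncatedWittVector p (k + 1) B) ⧸ (psiC p B k).range

instance (k : ℕ) : AddCommGroup (QC p B k) :=
  QuotientAddGroup.Quotient.addCommGroup _

/-- Projection onto the pushout `Q_{B,k+1}`. -/
def mkC (k : ℕ) : B × TruncatedWittVector p (k + 1) B →+ QC p B k :=
  QuotientAddGroup.mk' _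

/-- The pushout structure map `Φ_{B,k+1} : B → Q_{B,k+1}`. -/
def PhiC (k : ℕ) (b : B) : QC p B k :=
  mkC p B k (b, 0)

/-- The action of `W_{k+1}(B)` on representatives of elements of `Q_{B,k+1}`. -/
def wsmulC (k : ℕ) (x : TruncatedWittVector p (k + 1) B)
    (mm : B × TruncatedWittVector p (k + 1) B) : B × TruncatedWittVector p (k + 1) B :=
  (wittRes p B k x * mm.1, wittFrobC p B (k + 1) x * mm.2)

/-- A ring `B` of characteristic `p` is quasi-`F`-split if for some `n = k + 1 ≥ 1` the pushout
structure map `Φ_{B,n} : B → Q_{B,n}` admits a `B`-linear retraction; a map `Q_{B,n} → B` is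
`B`-linear iff it is additive and `W_n(B)`-semilinear with respect to `R^{n-1}`. -/
def QuasiFSplit : Prop :=
  ∃ (k : ℕ) (s : QC p B k →+ B),
    (∀ (x : TruncatedWittVector p (k + 1) B) (mm : B × TruncatedWittVector p (k + 1) B),
      s (mkC p B k (wsmulC p B k x mm)) = wittRes p B k x * s (mkC p B k mm)) ∧
    (∀ b : B, s (PhiC p B k b) = b)

end CharP

theorem wittFrobC_truncate (B : Type) [CommRing B] [CharP B p] (n : ℕ) (x : WittVector p B) :
    wittFrobC p B n (WittVector.truncate n x) = WittVector.truncate n (frobenius x) :=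
  RingHom.liftOfRightInverse_comp_apply _ _ _ _ x

variable {A}

/-- The ring homomorphism `W_n(A) → W_n(B)` induced by a ring homomorphism `A → B`. -/
def wittMap {B : Type} [CommRing B] (f : A →+* B) (n : ℕ) :
    TruncatedWittVector p n A →+* TruncatedWittVector p n B :=
  (RingHom.liftOfSurjective (WittVector.truncate (p := p) (R := A) n)
    (WittVector.truncate_surjective p n A))
    ⟨(WittVector.truncate n).comp (WittVector.map f), by
      intro x hx
      rw [WittVector.mem_ker_truncate] at hx
      rw [RingHom.mem_ker, RingHom.comp_apply, ← RingHom.mem_ker, WittVector.mem_ker_truncate]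
      intro i hi
      rw [WittVector.map_coeff, hx i hi, map_zero]⟩

theorem wittMap_truncate {B : Type} [CommRing B] (f : A →+* B) (n : ℕ) (x : WittVector p A) :
    wittMap p f n (WittVector.truncate n x) = WittVector.truncate n (WittVector.map f x) :=
  RingHom.liftOfRightInverse_comp_apply _ _ _ _ x

theorem wittRes_map_truncate {B : Type} [CommRing B] (f : A →+* B) (k n : ℕ)
    (x : WittVector p A) :
    wittRes p B k (WittVector.truncate (k + 1) (WittVector.map f x)) =
      f (wittRes p A n (WittVector.truncate (n + 1) x)) := by
  rw [wittRes_truncate, wittRes_truncate, WittVector.map_coeff]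

theorem wittFrobC_map_truncate {B : Type} [CommRing B] [CharP B p] (f : A →+* B) (n : ℕ)
    (x : WittVector p A) :
    wittFrobC p B n (WittVector.truncate n (WittVector.map f x)) =
      wittMap p f n (wittFrob p A n (WittVector.truncate (n + 1) x)) := by
  rw [wittFrobC_truncate, wittFrob_truncate, wittMap_truncate,
    (frobenius_isPoly p).map f x]

/-- The map `Q_{A,k+1} → Q_{B,k+1}` induced by a ring homomorphism `f : A → B` to a ring of
characteristic `p`. -/
def QMToQC {B : Type} [CommRing B] [CharP B p] (f : A →+* B) (k : ℕ) :
    QM p A (k + 1) →+ QC p B k :=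
  QuotientAddGroup.map _ _
    (f.toAddMonoidHom.prodMap (wittMap p f (k + 1)).toAddMonoidHom) (by
      rintro _ ⟨x, rfl⟩
      obtain ⟨x, rfl⟩ := WittVector.truncate_surjective p (k + 1 + 1) A x
      refine ⟨WittVector.truncate (k + 1) (WittVector.map f x), Prod.ext ?_ ?_⟩
      · exact wittRes_map_truncate p f k (k + 1) x
      · exact (congrArg Neg.neg (wittFrobC_map_truncate p f (k + 1) x)).trans
          (map_neg (wittMap p f (k + 1)) _).symm)

theorem QMToQC_mkM {B : Type} [CommRing B] [CharP B p] (f : A →+* B) (k : ℕ)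
    (m : A × TruncatedWittVector p (k + 1) A) :
    QMToQC p f k (mkM p A (k + 1) m) = mkC p B k (f m.1, wittMap p f (k + 1) m.2) :=
  rfl

variable (A)

/-- Let `A` be a normal Noetherian domain which is `p`-torsion-free and such
that `A/pA` is `F`-finite of characteristic `p`.  If `A/pA` is quasi-`F`-split, then `A` is
quasi-`F`-split in the mixed-characteristic sense: there are `n ≥ 1` and an `A`-module
homomorphism `s : Q_{A,n} → A/pA` (an additive map which is `A`-linear, i.e.
`W_{n+1}(A)`-semilinear with respect to `R^n : W_{n+1}(A) → A`) such that the composite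
`s ∘ Φ̃_{A,n} : A → A/pA` is the canonical surjection. -/
theorem quasiFSplit_of_quasiFSplit_mod_p
    [IsDomain A] [IsIntegrallyClosed A] [IsNoetherianRing A]
    (hptf : ∀ a : A, (p : A) * a = 0 → a = 0)
    [CharP (A ⧸ Ideal.span {(p : A)}) p]
    (hFf : (frobenius (A ⧸ Ideal.span {(p : A)}) p).Finite)
    (hQFS : QuasiFSplit p (A ⧸ Ideal.span {(p : A)})) :
    ∃ n : ℕ, 1 ≤ n ∧
      ∃ s : QM p A n →+ A ⧸ Ideal.span {(p : A)},
        (∀ (x : TruncatedWittVector p (n + 1) A) (mm : A × TruncatedWittVector p n A),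
          s (mkM p A n (wsmulM p A n x mm)) =
            Ideal.Quotient.mk (Ideal.span {(p : A)}) (wittRes p A n x) * s (mkM p A n mm)) ∧
        (∀ a : A, s (PhiM p A n a) = Ideal.Quotient.mk (Ideal.span {(p : A)}) a) := by
  obtain ⟨k, s, hs, hs'⟩ := hQFS
  set f := Ideal.Quotient.mk (Ideal.span {(p : A)})
  refine ⟨k + 1, by omega, s.comp (QMToQC p f k), ?_, ?_⟩
  · intro x m
    obtain ⟨x, rfl⟩ := WittVector.truncate_surjective p (k + 1 + 1) A x
    have h := hs (WittVector.truncate (k + 1) (WittVector.map f x))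
      (f m.1, wittMap p f (k + 1) m.2)
    rw [wsmulC, wittFrobC_map_truncate, wittRes_map_truncate p f k (k + 1)] at h
    simpa only [AddMonoidHom.comp_apply, QMToQC_mkM, wsmulM, map_mul] using h
  · intro a
    rw [AddMonoidHom.comp_apply, PhiM, QMToQC_mkM, map_zero]
    exact hs' (f a)

end QFS
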